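/- Let M be an additive abelian group, let B be a commutative ring with an M-grading B = ⊕_{m∈M} B_m, and let I ⊆ B be a homogeneous ideal with I_m = B_m for all m ≠ 0 and such that (B₀, I₀) is a henselian pair, where I₀ := I ∩ B₀. Let P be a finitely generated M-graded B-module annihilated by I which is projective as a module over the quotient ring B/I. Then there exist a finitely generated M-graded B-module E, projective as a B-module, and a surjective graded B-linear map E → P whose kernel equals I·E. -/

import Mathlib

universe u v w

section

open Polynomial
open scoped Matrix

/-- The root condition of Gabber for henselian pairs. -/
theorem HenselianRing.exists_isRoot_sub_one_mem {R : Type*} [CommRing R] {J : Ideal R}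
    (hR : HenselianRing R J) {f : R[X]} (hf : f.Monic) {n : ℕ}
    (hfJ : f.map (Ideal.Quotient.mk J) = (X - 1) * X ^ n) :
    ∃ a : R, f.IsRoot a ∧ a - 1 ∈ J := by
  refine hR.is_henselian f hf 1 ?_ ?_
  · rw [← Ideal.Quotient.eq_zero_iff_mem, ← eval_map_apply, hfJ]
    simp
  · rw [← eval_map_apply, ← derivative_map, hfJ]
    simp

theorem Matrix.aeval_charpoly_mul_eq_zero {R S ι : Type*} [CommRing R] [CommRing S] [Algebra R S]
    [Fintype ι] [DecidableEq ι] (A : Matrix ι ι R) (e : S) (v : ι → S)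
    (h : ∀ i, e * v i = ∑ k, algebraMap R S (A i k) * v k) (i : ι) :
    aeval e A.charpoly * v i = 0 := by
  have h1 : (Matrix.scalar ι e - A.map (algebraMap R S)) *ᵥ v = 0 := by
    ext i
    simp [Matrix.mulVec, dotProduct, h i, Matrix.diagonal_apply, sub_mul]
  have h2 : aeval e A.charpoly = (Matrix.scalar ι e - A.map (algebraMap R S)).det := by
    rw [← Matrix.eval_charpoly, Matrix.charpoly_map, eval_map_algebraMap]
  have h3 := congr_arg ((Matrix.scalar ι e - A.map (algebraMap R S)).adjugate *ᵥ ·) h1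
  simp only [Matrix.mulVec_mulVec, Matrix.adjugate_mul, Matrix.mulVec_zero] at h3
  rw [h2]
  simpa [Matrix.smul_mulVec] using congr_fun h3 i

theorem Ideal.exists_sum_eq_of_mem_map {R S ι : Type*} [CommRing R] [CommRing S] [Algebra R S]
    [Fintype ι] (J : Ideal R) (z : ι → S) (hz : Submodule.span R (Set.range z) = ⊤) {x : S}
    (hx : x ∈ J.map (algebraMap R S)) :
    ∃ c : ι → R, (∀ i, c i ∈ J) ∧ x = ∑ i, algebraMap R S (c i) * z i := by
  have : x ∈ J • Submodule.span R (Set.range z) := by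
    rw [hz, Ideal.smul_top_eq_map]
    exact hx
  obtain ⟨c, hc, h⟩ := (Submodule.mem_ideal_smul_span_iff_exists_sum _ _ _).mp this
  refine ⟨c, hc, ?_⟩
  rw [← h, Finsupp.sum_fintype _ _ (by simp)]
  simp [Algebra.smul_def]

/-- In a finite algebra over a henselian pair, an idempotent modulo `J` generating a cyclic
`R ⧸ J`-module lifts to an idempotent. -/
theorem HenselianRing.exists_isIdempotentElem_of_cyclic {R S : Type*} [CommRing R] [CommRing S]
    [Algebra R S] [Module.Finite R S] {J : Ideal R} (hR : HenselianRing R J) (e : S)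
    (he : e * e - e ∈ J.map (algebraMap R S))
    (hcyc : ∀ x : S, ∃ r : R, e * x - algebraMap R S r * e ∈ J.map (algebraMap R S)) :
    ∃ ε : S, IsIdempotentElem ε ∧ ε - e ∈ J.map (algebraMap R S) := by
  obtain ⟨n, z, hz⟩ := Module.Finite.exists_fin (R := R) (M := S)
  choose r hr using fun i => hcyc (z i)
  obtain ⟨c₀, hc₀, h₀⟩ := J.exists_sum_eq_of_mem_map z hz he
  choose c hc h using fun i => J.exists_sum_eq_of_mem_map z hz (hr i)
  let A : Matrix (Unit ⊕ Fin n) (Unit ⊕ Fin n) R :=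
    Matrix.fromBlocks 1 (Matrix.of fun _ k => c₀ k) (Matrix.of fun i _ => r i) (Matrix.of c)
  have hAz := A.aeval_charpoly_mul_eq_zero e (Sum.elim (fun _ => e) z) (by
    rintro (i | i)
    · simp [A, ← h₀]
    · simp [A, ← h])
  have hroot : aeval e A.charpoly = 0 := by
    have : (1 : S) ∈ Submodule.span R (Set.range z) := hz ▸ Submodule.mem_top
    obtain ⟨d, hd⟩ := (Submodule.mem_span_range_iff_exists_fun R).mp this
    rw [← mul_one (aeval e A.charpoly), ← hd, Finset.mul_sum]
    refine Finset.sum_eq_zero fun i _ => ?_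
    rw [mul_smul_comm]
    simpa using congr_arg (d i • ·) (hAz (Sum.inr i))
  have hAJ : A.charpoly.map (Ideal.Quotient.mk J) = (X - 1) * X ^ n := by
    rw [← Matrix.charpoly_map]
    have : A.map (Ideal.Quotient.mk J) = Matrix.fromBlocks 1 0
        (Matrix.of fun i _ => Ideal.Quotient.mk J (r i)) 0 := by
      rw [Matrix.fromBlocks_map]
      congr 1
      · ext i k
        simpa using Ideal.Quotient.eq_zero_iff_mem.mpr (hc₀ k)
      · ext i k
        simpa using Ideal.Quotient.eq_zero_iff_mem.mpr (hc i k)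
    rw [this, Matrix.charpoly_fromBlocks_zero₁₂, Matrix.charpoly_zero, Matrix.charpoly_one]
    simp
  obtain ⟨a, ha, haJ⟩ := hR.exists_isRoot_sub_one_mem A.charpoly_monic hAJ
  obtain ⟨g, hg⟩ := dvd_iff_isRoot.mpr ha
  have hgJ : g.map (Ideal.Quotient.mk J) = X ^ n := by
    rw [hg] at hAJ
    have ha1 : Ideal.Quotient.mk J a = 1 := by
      rw [← sub_eq_zero, ← map_one (Ideal.Quotient.mk J), ← map_sub]
      exact Ideal.Quotient.eq_zero_iff_mem.mpr haJ
    have h1 : (X - C 1 : (R ⧸ J)[X]) = X - 1 := by simp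
    simp only [Polynomial.map_mul, Polynomial.map_sub, map_X, map_C, ha1, h1] at hAJ
    exact (h1 ▸ monic_X_sub_C (1 : R ⧸ J)).isRegular.left hAJ
  have ha1 : Ideal.Quotient.mk J a = 1 := by
    rw [← sub_eq_zero, ← map_one (Ideal.Quotient.mk J), ← map_sub]
    exact Ideal.Quotient.eq_zero_iff_mem.mpr haJ
  have hga : Ideal.Quotient.mk J (g.eval a) = 1 := by
    rw [← eval_map_apply, hgJ]
    simp [ha1]
  have := isLocalHom_of_le_jacobson_bot J hR.jac
  have hu : IsUnit (g.eval a) := IsUnit.of_map (Ideal.Quotient.mk J) _ (by simp [hga])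
  obtain ⟨u, hu⟩ := hu
  have hG (q : R[X]) : aeval e q * aeval e g = algebraMap R S (q.eval a) * aeval e g := by
    obtain ⟨d, hd⟩ := X_sub_C_dvd_sub_C_eval (a := a) (p := q)
    have h1 := congr_arg (aeval e) hd
    have h2 := hroot
    rw [hg] at h2
    simp only [map_sub, map_mul, aeval_C, aeval_X] at h1 h2
    linear_combination aeval e g * h1 + aeval e d * h2
  have hu' : algebraMap R S ↑u⁻¹ * algebraMap R S (g.eval a) = 1 := by
    rw [← map_mul, ← hu, Units.inv_mul, map_one]
  refine ⟨algebraMap R S ↑u⁻¹ * aeval e g, ?_, ?_⟩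
  · have := hG g
    rw [IsIdempotentElem]
    linear_combination (algebraMap R S ↑u⁻¹) ^ 2 * this +
      algebraMap R S ↑u⁻¹ * aeval e g * hu'
  · let φ : R ⧸ J →+* S ⧸ J.map (algebraMap R S) :=
      Ideal.quotientMap _ (algebraMap R S) Ideal.le_comap_map
    have hφ (x : R) : Ideal.Quotient.mk (J.map (algebraMap R S)) (algebraMap R S x) =
        φ (Ideal.Quotient.mk J x) := rfl
    have hidem : IsIdempotentElem (Ideal.Quotient.mk (J.map (algebraMap R S)) e) := by
      rw [IsIdempotentElem, ← sub_eq_zero, ← map_mul, ← map_sub]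
      exact Ideal.Quotient.eq_zero_iff_mem.mpr he
    have h1 : Ideal.Quotient.mk (J.map (algebraMap R S)) (aeval e g) =
        Ideal.Quotient.mk (J.map (algebraMap R S)) e ^ n := by
      rw [aeval_def, hom_eval₂]
      change eval₂ (φ.comp (Ideal.Quotient.mk J)) _ _ = _
      rw [← eval₂_map, hgJ]
      simp
    have h2 := congr_arg (Ideal.Quotient.mk (J.map (algebraMap R S))) hu'
    rw [map_mul, hφ (g.eval a), hga, map_one, mul_one, map_one] at h2
    rw [← Ideal.Quotient.eq_zero_iff_mem, map_sub, map_mul, h1, h2, one_mul]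
    cases n with
    | zero =>
      have : Subsingleton S := by
        rw [← Submodule.subsingleton_iff R, ← subsingleton_iff_bot_eq_top, ← hz]
        simp [Set.range_eq_empty]
      have : e = 1 := Subsingleton.elim _ _
      simp [this]
    | succ n => rw [hidem.pow_succ_eq, sub_self]

theorem HenselianRing.exists_algHom_lift {R : Type*} [CommRing R] {J : Ideal R}
    (hR : HenselianRing R J) {S : Type*} [CommRing S] [Algebra R S] [Module.Finite R S]
    [Algebra.FinitePresentation R S] (Δ : S) [Algebra.Etale R (Localization.Away Δ)]
    (σ : S →ₐ[R] R ⧸ J) (hσ : IsUnit (σ Δ)) :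
    ∃ τ : S →ₐ[R] R, ∀ x, Ideal.Quotient.mk J (τ x) = σ x := by
  have hloc := isLocalHom_of_le_jacobson_bot J hR.jac
  set JS := J.map (algebraMap R S) with hJS
  let K : Ideal S := RingHom.ker σ
  have hJK : JS ≤ K := Ideal.map_le_iff_le_comap.mpr fun r hr => by
    simpa [K, RingHom.mem_ker] using Ideal.Quotient.eq_zero_iff_mem.mpr hr
  have hσr (x : S) : ∃ r : R, σ x = Ideal.Quotient.mk J r ∧ x - algebraMap R S r ∈ K := by
    obtain ⟨r, hr⟩ := Ideal.Quotient.mk_surjective (σ x)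
    refine ⟨r, hr.symm, ?_⟩
    simp [K, RingHom.mem_ker, ← hr]
  -- unramifiedness
  have hK2 : K ≤ JS ⊔ K * K := by
    let L := JS ⊔ K * K
    have hLK : L ≤ K := sup_le hJK Ideal.mul_le_right
    let f₁ : S →ₐ[R] S ⧸ L := Ideal.Quotient.mkₐ R L
    let g : R ⧸ J →ₐ[R] S ⧸ L := Ideal.Quotient.liftₐ J (Algebra.ofId R (S ⧸ L)) (by
      intro r hr
      rw [Algebra.ofId_apply, IsScalarTower.algebraMap_apply R S, Ideal.Quotient.algebraMap_eq,
        Ideal.Quotient.eq_zero_iff_mem]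
      exact Ideal.mem_sup_left (Ideal.mem_map_of_mem _ hr))
    let f₂ : S →ₐ[R] S ⧸ L := g.comp σ
    let N : Ideal (S ⧸ L) := K.map (Ideal.Quotient.mk L)
    have hN : IsNilpotent N := by
      refine ⟨2, ?_⟩
      rw [pow_two, ← Ideal.map_mul, Ideal.zero_eq_bot, Ideal.map_eq_bot_iff_le_ker, Ideal.mk_ker]
      exact le_sup_right
    have hf (x : S) : f₁ x - f₂ x ∈ N := by
      obtain ⟨r, hr, hxr⟩ := hσr x
      have : f₁ x - f₂ x = Ideal.Quotient.mk L (x - algebraMap R S r) := by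
        have h2 : f₂ x = algebraMap R (S ⧸ L) r := by
          simp only [f₂, AlgHom.comp_apply, hr]
          exact g.commutes r
        rw [h2, map_sub]
        rfl
      rw [this]
      exact Ideal.mem_map_of_mem _ hxr
    have hu₂ : IsUnit (f₂ Δ) := hσ.map g
    have hu₁ : IsUnit (f₁ Δ) := by
      have hn : IsNilpotent (f₁ Δ - f₂ Δ) := by
        obtain ⟨k, hk⟩ := hN
        exact ⟨k, by simpa [hk] using Ideal.pow_mem_pow (hf Δ) k⟩
      have := hn.isUnit_add_left_of_commute hu₂ (Commute.all _ _)
      simpa using this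
    have heq : (IsLocalization.Away.liftAlgHom (S := Localization.Away Δ) Δ hu₁) =
        (IsLocalization.Away.liftAlgHom Δ hu₂) := by
      refine Algebra.FormallyUnramified.ext (R := R) (I := N) hN fun x => ?_
      refine RingHom.congr_fun (f := (Ideal.Quotient.mk N).comp
        (IsLocalization.Away.liftAlgHom (S := Localization.Away Δ) Δ hu₁).toRingHom)
        (g := (Ideal.Quotient.mk N).comp
        (IsLocalization.Away.liftAlgHom (S := Localization.Away Δ) Δ hu₂).toRingHom) ?_ x
      refine IsLocalization.ringHom_ext (Submonoid.powers Δ) (RingHom.ext fun y => ?_)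
      simpa [IsLocalization.Away.liftAlgHom, Ideal.Quotient.eq] using hf y
    intro x hx
    have h := AlgHom.congr_fun heq (algebraMap S _ x)
    have hx' : σ x = 0 := hx
    simp [IsLocalization.Away.liftAlgHom, f₂, hx', f₁] at h
    exact Ideal.Quotient.eq_zero_iff_mem.mp h
  -- the kernel is finitely generated modulo J
  obtain ⟨e, heK, heJ⟩ : ∃ e : S, e - 1 ∈ K ∧ ∀ x ∈ K, e * x ∈ JS := by
    obtain ⟨n, z, hz⟩ := Module.Finite.exists_fin (R := R) (M := S)
    choose r hr hk using fun i => hσr (z i)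
    let K₀ : Ideal S := Ideal.span (Set.range fun i => z i - algebraMap R S (r i))
    have hK₀ : K₀ ≤ K := Ideal.span_le.mpr (by rintro _ ⟨i, rfl⟩; exact hk i)
    have hKK₀ : K ≤ JS ⊔ K₀ := by
      intro x hx
      obtain ⟨c, hc⟩ := (Submodule.mem_span_range_iff_exists_fun R).mp
        (hz ▸ Submodule.mem_top : x ∈ Submodule.span R (Set.range z))
      have h1 : x = algebraMap R S (∑ i, c i * r i) +
          ∑ i, algebraMap R S (c i) * (z i - algebraMap R S (r i)) := by
        rw [← hc, map_sum, ← Finset.sum_add_distrib]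
        refine Finset.sum_congr rfl fun i _ => ?_
        rw [map_mul, Algebra.smul_def]
        ring
      have h2 : ∑ i, algebraMap R S (c i) * (z i - algebraMap R S (r i)) ∈ K₀ :=
        K₀.sum_mem fun i _ => K₀.mul_mem_left _ (Ideal.subset_span ⟨i, rfl⟩)
      rw [h1]
      refine add_mem (Ideal.mem_sup_left (Ideal.mem_map_of_mem _ ?_)) (Ideal.mem_sup_right h2)
      have h3 : algebraMap R S (∑ i, c i * r i) ∈ K := by
        rw [eq_sub_of_add_eq h1.symm]
        exact K.sub_mem hx (hK₀ h2)
      have h4 : σ (algebraMap R S (∑ i, c i * r i)) = 0 := h3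
      rw [AlgHom.commutes] at h4
      exact Ideal.Quotient.eq_zero_iff_mem.mp h4
    obtain ⟨e, he, heK⟩ := Submodule.exists_sub_one_mem_and_smul_le_of_fg_of_le_sup
      (I := K) (N := JS) (N' := K₀) (P := K) (Submodule.fg_span (Set.finite_range _)) hK₀ (by
        refine hK2.trans (sup_le le_sup_left ?_)
        refine (Ideal.mul_mono_right hKK₀).trans ?_
        rw [Ideal.mul_sup]
        exact sup_le_sup Ideal.mul_le_right le_rfl)
    exact ⟨e, he, fun x hx => heK (Submodule.smul_mem_pointwise_smul x e K hx)⟩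
  obtain ⟨ε, hε, hεe⟩ := hR.exists_isIdempotentElem_of_cyclic e
    (by simpa [mul_sub] using heJ _ heK) (fun x => by
      obtain ⟨r, -, hr⟩ := hσr x
      exact ⟨r, by simpa [mul_sub, mul_comm] using heJ _ hr⟩)
  have hεK : 1 - ε ∈ K := by
    have := K.add_mem (hJK hεe) heK
    rw [← neg_mem_iff]
    simpa using this
  have hεJ (x) (hx : x ∈ K) : ε * x ∈ JS := by
    have := JS.add_mem (JS.mul_mem_right x hεe) (heJ x hx)
    rwa [← add_mul, sub_add_cancel] at this
  let E : Ideal S := Ideal.span {1 - ε}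
  have hEK : E ≤ K := (Ideal.span_singleton_le_iff_mem K).mpr hεK
  have hmkε : Ideal.Quotient.mk E ε = 1 := by
    rw [eq_comm, ← sub_eq_zero, ← map_one (Ideal.Quotient.mk E), ← map_sub]
    exact Ideal.Quotient.eq_zero_iff_mem.mpr (Ideal.mem_span_singleton_self _)
  let σ' : S ⧸ E →ₐ[R] R ⧸ J := Ideal.Quotient.liftₐ E σ fun x hx => hEK hx
  have hσ' (x : S) : σ' (Ideal.Quotient.mk E x) = σ x := rfl
  -- Nakayama
  have hsurj : Function.Surjective (algebraMap R (S ⧸ E)) := by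
    have htop : (⊤ : Submodule R (S ⧸ E)) ≤ Submodule.span R {1} := by
      refine Submodule.le_of_le_smul_of_le_jacobson_bot Module.Finite.fg_top hR.jac ?_
      rintro y -
      obtain ⟨x, rfl⟩ := Ideal.Quotient.mk_surjective y
      obtain ⟨r, -, hr⟩ := hσr x
      have h1 : Ideal.Quotient.mk E x = r • (1 : S ⧸ E) +
          Ideal.Quotient.mk E (ε * (x - algebraMap R S r)) := by
        rw [map_mul, hmkε, one_mul, map_sub, Algebra.smul_def, mul_one]
        exact (add_sub_cancel _ _).symm
      rw [h1]
      refine Submodule.add_mem_sup (Submodule.smul_mem _ _ (Submodule.mem_span_singleton_self _)) ?_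
      rw [Ideal.smul_top_eq_map]
      have h2 := Ideal.mem_map_of_mem (Ideal.Quotient.mk E) (hεJ _ hr)
      rw [hJS, Ideal.map_map] at h2
      exact h2
    intro y
    obtain ⟨r, hr⟩ := Submodule.mem_span_singleton.mp (htop (Submodule.mem_top (x := y)))
    exact ⟨r, by rw [← hr, Algebra.smul_def, mul_one]⟩
  -- injectivity
  have hinj : RingHom.ker (algebraMap R (S ⧸ E)) = ⊥ := by
    set k := RingHom.ker (algebraMap R (S ⧸ E)) with hk
    have hkJ : k ≤ J := by
      intro r hr
      have h1 : σ' (algebraMap R (S ⧸ E) r) = 0 := by rw [(RingHom.mem_ker).mp hr, map_zero]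
      rw [AlgHom.commutes] at h1
      exact Ideal.Quotient.eq_zero_iff_mem.mp h1
    have hfg : k.FG := by
      have : Algebra.FinitePresentation R (S ⧸ E) :=
        Algebra.FinitePresentation.quotient (Submodule.fg_span_singleton _)
      exact Algebra.FinitePresentation.ker_fG_of_surjective (Algebra.ofId R (S ⧸ E)) hsurj
    refine Submodule.eq_bot_of_le_smul_of_le_jacobson_bot k k hfg ?_ (hkJ.trans hR.jac)
    have hΔ : IsUnit (Ideal.Quotient.mkₐ R E Δ) := by
      obtain ⟨d, hd⟩ := hsurj (Ideal.Quotient.mk E Δ)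
      have h1 : σ Δ = Ideal.Quotient.mk J d := by
        rw [← hσ', ← hd, AlgHom.commutes]
        rfl
      have h2 : IsUnit d := IsUnit.of_map (Ideal.Quotient.mk J) _ (h1 ▸ hσ)
      exact hd ▸ h2.map (algebraMap R (S ⧸ E))
    let h : Localization.Away Δ →ₐ[R] S ⧸ E := IsLocalization.Away.liftAlgHom Δ hΔ
    let g : R ⧸ (k * k) →ₐ[R] S ⧸ E := Ideal.Quotient.liftₐ (k * k) (Algebra.ofId R _)
      fun x hx => (Ideal.mul_le_left hx : x ∈ k)
    have hg : Function.Surjective g := by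
      intro y
      obtain ⟨r, hr⟩ := hsurj y
      exact ⟨Ideal.Quotient.mk _ r, hr⟩
    have hg2 (x) (hx : g x = 0) : x * x = 0 := by
      obtain ⟨r, rfl⟩ := Ideal.Quotient.mk_surjective x
      have : r ∈ k := hx
      rw [← map_mul]
      exact Ideal.Quotient.eq_zero_iff_mem.mpr (Ideal.mul_mem_mul this this)
    have hgN : IsNilpotent (RingHom.ker (g : R ⧸ (k * k) →+* S ⧸ E)) := by
      refine ⟨2, ?_⟩
      rw [pow_two, Ideal.zero_eq_bot, eq_bot_iff, Ideal.mul_le]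
      intro x hx y hy
      obtain ⟨r, rfl⟩ := Ideal.Quotient.mk_surjective x
      obtain ⟨s, rfl⟩ := Ideal.Quotient.mk_surjective y
      have h1 : r ∈ k := hx
      have h2 : s ∈ k := hy
      rw [← map_mul]
      exact Ideal.Quotient.eq_zero_iff_mem.mpr (Ideal.mul_mem_mul h1 h2)
    let l := Algebra.FormallySmooth.liftOfSurjective h g hg hgN
    let l' : S →ₐ[R] R ⧸ (k * k) := l.comp (IsScalarTower.toAlgHom R S _)
    have hl' (x : S) : g (l' x) = Ideal.Quotient.mk E x := by
      refine (Algebra.FormallySmooth.liftOfSurjective_apply h g hg hgN _).trans ?_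
      exact IsLocalization.Away.lift_eq Δ hΔ x
    have hl1 : 1 - l' ε = 0 := by
      have h1 : IsIdempotentElem (1 - l' ε) := (hε.map l').one_sub
      rw [← h1.eq]
      apply hg2
      rw [map_sub, hl', hmkε, map_one, sub_self]
    intro r hr
    have h1 : algebraMap R S r ∈ E := Ideal.Quotient.eq_zero_iff_mem.mp hr
    obtain ⟨c, hc⟩ := Ideal.mem_span_singleton'.mp h1
    have h2 := congr_arg l' hc
    rw [map_mul, map_sub, map_one, hl1, mul_zero, AlgHom.commutes] at h2
    exact Ideal.Quotient.eq_zero_iff_mem.mp h2.symm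
  let eqv : R ≃ₐ[R] S ⧸ E := AlgEquiv.ofBijective (Algebra.ofId R (S ⧸ E))
    ⟨(RingHom.injective_iff_ker_eq_bot _).mpr hinj, hsurj⟩
  refine ⟨eqv.symm.toAlgHom.comp (Ideal.Quotient.mkₐ R E), fun x => ?_⟩
  have h1 : algebraMap R (S ⧸ E) (eqv.symm (Ideal.Quotient.mk E x)) = Ideal.Quotient.mk E x :=
    eqv.apply_symm_apply _
  rw [← hσ', ← h1, AlgHom.commutes]
  rfl

theorem HenselianRing.exists_monic_mul_eq {R : Type*} [CommRing R] {J : Ideal R}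
    (hR : HenselianRing R J) {p : R[X]} (hp : p.Monic) {g h : (R ⧸ J)[X]} (hg : g.Monic)
    (hh : h.Monic) (hgh : IsCoprime g h) (hpgh : p.map (Ideal.Quotient.mk J) = g * h) :
    ∃ G H : R[X], G.Monic ∧ H.Monic ∧ IsCoprime G H ∧ p = G * H ∧
      G.map (Ideal.Quotient.mk J) = g ∧ H.map (Ideal.Quotient.mk J) = h := by
  by_cases hnt : Nontrivial (R ⧸ J)
  swap
  · rw [not_nontrivial_iff_subsingleton] at hnt
    exact ⟨p, 1, hp, monic_one, isCoprime_one_right, (mul_one p).symm,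
      Subsingleton.elim _ _, Subsingleton.elim _ _⟩
  have hn : p.natDegree = g.natDegree + h.natDegree := by
    rw [← hp.natDegree_map (Ideal.Quotient.mk J), hpgh, hg.natDegree_mul hh]
  let P : MonicDegreeEq R p.natDegree := .mk p hp rfl
  let q : MonicDegreeEq (R ⧸ J) g.natDegree × MonicDegreeEq (R ⧸ J) h.natDegree :=
    (.mk g hg rfl, .mk h hh rfl)
  let σ' : UniversalCoprimeFactorizationRing _ _ hn P →ₐ[R] R ⧸ J :=
    (UniversalCoprimeFactorizationRing.homEquiv (R ⧸ J) _ _ hn P).symm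
      ⟨q, hpgh.symm, hgh⟩
  let Δ := (UniversalFactorizationRing.presentation _ _ hn P).jacobian
  let σ := σ'.comp (IsScalarTower.toAlgHom R (UniversalFactorizationRing _ _ hn P) _)
  have hσ : IsUnit (σ Δ) :=
    (IsLocalization.Away.algebraMap_isUnit (S := Localization.Away Δ) Δ).map σ'
  obtain ⟨τ, hτ⟩ := hR.exists_algHom_lift Δ σ hσ
  have hloc := isLocalHom_of_le_jacobson_bot J hR.jac
  have hτΔ : IsUnit (τ Δ) := IsUnit.of_map (Ideal.Quotient.mk J) _ (hτ Δ ▸ hσ)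
  let τ' : UniversalCoprimeFactorizationRing _ _ hn P →ₐ[R] R :=
    IsLocalization.Away.liftAlgHom Δ hτΔ
  have hcomp : (Ideal.Quotient.mkₐ R J).comp τ' = σ' := by
    refine AlgHom.coe_ringHom_injective ?_
    refine IsLocalization.ringHom_ext (Submonoid.powers Δ) (RingHom.ext fun y => ?_)
    have : τ' (algebraMap _ _ y) = τ y := IsLocalization.Away.lift_eq Δ hτΔ y
    change Ideal.Quotient.mk J (τ' (algebraMap _ _ y)) = σ y
    rw [this, hτ]
  let Q := UniversalCoprimeFactorizationRing.homEquiv R _ _ hn P τ'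
  have hQ : UniversalCoprimeFactorizationRing.homEquiv (R ⧸ J) _ _ hn P σ' =
      ⟨q, hpgh.symm, hgh⟩ := Equiv.apply_symm_apply _ _
  have h1 := UniversalCoprimeFactorizationRing.homEquiv_comp_fst _ _ _ hn P τ'
    (Ideal.Quotient.mkₐ R J)
  have h2 := UniversalCoprimeFactorizationRing.homEquiv_comp_snd _ _ _ hn P τ'
    (Ideal.Quotient.mkₐ R J)
  rw [hcomp, hQ] at h1 h2
  refine ⟨Q.1.1.1, Q.1.2.1, Q.1.1.monic, Q.1.2.monic, Q.2.2, ?_, ?_, ?_⟩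
  · simpa [P] using Q.2.1.symm
  · exact (congr_arg Subtype.val h1).symm
  · exact (congr_arg Subtype.val h2).symm

/-- An element `a` of an algebra, with `a` satisfying a monic equation that is congruent to a
power of `T ^ 2 - T`, gives rise to an idempotent. -/
theorem HenselianRing.exists_isIdempotentElem_aeval {R : Type*} [CommRing R] {J : Ideal R}
    (hR : HenselianRing R J) {p : R[X]} (hp : p.Monic) {n : ℕ}
    (hpJ : p.map (Ideal.Quotient.mk J) = (X ^ 2 - X) ^ (n + 1)) :
    ∃ q : R[X], p ∣ q ^ 2 - q ∧
      (X ^ 2 - X) ∣ q.map (Ideal.Quotient.mk J) - X := by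
  have h1 : (X - C 1 : (R ⧸ J)[X]) = X - 1 := by simp
  obtain ⟨G, H, hG, hH, ⟨u, v, huv⟩, rfl, hGJ, hHJ⟩ := hR.exists_monic_mul_eq hp
    (g := X ^ (n + 1)) (h := (X - 1) ^ (n + 1)) (monic_X_pow _)
    (h1 ▸ (monic_X_sub_C 1).pow _)
    (IsCoprime.pow ⟨1, -1, by ring⟩) (by rw [hpJ, ← mul_pow]; ring)
  refine ⟨u * G, ⟨-(u * v), by linear_combination (u * G) * huv⟩, ?_⟩
  have h2 := congr_arg (Polynomial.map (Ideal.Quotient.mk J)) huv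
  simp only [Polynomial.map_add, Polynomial.map_mul, hGJ, hHJ, Polynomial.map_one] at h2 ⊢
  set u' := u.map (Ideal.Quotient.mk J)
  set v' := v.map (Ideal.Quotient.mk J)
  refine ⟨- u' * X ^ n - v' * (X - 1) ^ n, ?_⟩
  linear_combination X * h2

theorem HenselianRing.exists_isIdempotentElem_matrix {R ι : Type*} [CommRing R] {J : Ideal R}
    [Fintype ι] [DecidableEq ι] (hR : HenselianRing R J) (A : Matrix ι ι R)
    (hA : IsIdempotentElem (A.map (Ideal.Quotient.mk J))) :
    ∃ q : R[X], IsIdempotentElem (aeval A q) ∧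
      (aeval A q).map (Ideal.Quotient.mk J) = A.map (Ideal.Quotient.mk J) := by
  let N := A ^ 2 - A
  let χ : R[X] := X * N.charpoly
  have hχ : χ.Monic := monic_X.mul N.charpoly_monic
  have hmap (B : Matrix ι ι R) : B.map (Ideal.Quotient.mk J) =
    (Ideal.Quotient.mk J).mapMatrix B := rfl
  have hN : N.map (Ideal.Quotient.mk J) = 0 := by
    rw [hmap] at hA ⊢
    rw [map_sub, map_pow, pow_two, hA.eq, sub_self]
  have hχJ : χ.map (Ideal.Quotient.mk J) = X ^ (Fintype.card ι + 1) := by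
    rw [Polynomial.map_mul, ← Matrix.charpoly_map, hN, Matrix.charpoly_zero, map_X, pow_succ']
  obtain ⟨q, ⟨c, hc⟩, hq⟩ := hR.exists_isIdempotentElem_aeval (p := χ.comp (X ^ 2 - X))
    (n := Fintype.card ι) (by
      nontriviality R
      have h2 : (X ^ 2 - X : R[X]).natDegree = 2 := by compute_degree!
      refine hχ.comp ?_ (by rw [h2]; norm_num)
      rw [Monic, leadingCoeff, h2]
      simp [coeff_X]) (by
      rw [Polynomial.map_comp, hχJ]
      simp)
  refine ⟨q, ?_, ?_⟩
  · have h := congr_arg (aeval A) hc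
    rw [map_mul, aeval_comp] at h
    have h3 : aeval A (X ^ 2 - X : R[X]) = N := by simp [N]
    rw [h3, map_mul, Matrix.aeval_self_charpoly] at h
    simp only [mul_zero, zero_mul, map_sub, map_pow] at h
    rw [IsIdempotentElem, ← pow_two]
    exact sub_eq_zero.mp h
  · obtain ⟨d, hd⟩ := hq
    have h4 := congr_arg (aeval ((Ideal.Quotient.mk J).mapMatrix A)) hd
    rw [hmap] at hA
    rw [map_mul, map_sub, map_sub, map_pow, aeval_X, pow_two, hA.eq, sub_self, zero_mul,
      sub_eq_zero] at h4
    rw [hmap, hmap, ← h4, aeval_def, aeval_def, eval₂_map, hom_eval₂]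
    congr 1
    ext r i j
    simp only [RingHom.comp_apply, RingHom.mapMatrix_apply, Matrix.map_apply,
      Matrix.algebraMap_matrix_apply]
    split_ifs <;> simp

section GradedRange

variable {M B ι : Type*} [AddCommGroup M] [CommRing B] [Fintype ι]

/-- The submodule `e B^ι` of the free graded module with generators in degrees `d`,
with its induced grading. -/
def Matrix.rangeGrading (𝒜 : M → AddSubgroup B) (d : ι → M) (e : Matrix ι ι B) (m : M) :
    AddSubgroup (LinearMap.range e.mulVecLin) where
  carrier := {x | ∀ i, x.1 i ∈ 𝒜 (m - d i)}
  add_mem' hx hy i := add_mem (hx i) (hy i)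
  zero_mem' _ := zero_mem _
  neg_mem' hx i := neg_mem (hx i)

theorem Matrix.rangeGrading_gradedSMul [DecidableEq M] (𝒜 : M → AddSubgroup B)
    [GradedRing 𝒜] (d : ι → M) (e : Matrix ι ι B) : SetLike.GradedSMul 𝒜 (e.rangeGrading 𝒜 d) where
  smul_mem {k m a x} ha hx i := by
    have := SetLike.mul_mem_graded ha (hx i)
    rw [vadd_eq_add, add_sub_assoc]
    exact this

theorem Matrix.rangeGrading_isInternal [DecidableEq M] (𝒜 : M → AddSubgroup B)
    [GradedRing 𝒜] (d : ι → M) (e : Matrix ι ι B) (he0 : ∀ i j, e i j ∈ 𝒜 0)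
    (hd : ∀ i j, d i ≠ d j → e i j = 0) : DirectSum.IsInternal (e.rangeGrading 𝒜 d) := by
  constructor
  · rw [injective_iff_map_eq_zero]
    intro x hx
    have key (x : DirectSum M fun m => e.rangeGrading 𝒜 d m) (m : M) (i : ι) :
        (DirectSum.decompose 𝒜 ((DirectSum.coeAddMonoidHom (e.rangeGrading 𝒜 d) x).1 i)
          (m - d i) : B) = (x m).1.1 i := by
      induction x using DirectSum.induction_on with
      | zero => simp
      | of k y =>
        rw [DirectSum.coeAddMonoidHom_of]
        by_cases hk : k = m
        · subst hk
          rw [DirectSum.decompose_of_mem_same 𝒜 (y.2 i), DirectSum.of_eq_same]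
        · rw [DirectSum.decompose_of_mem_ne 𝒜 (y.2 i) (by simpa using hk),
            DirectSum.of_eq_of_ne _ _ _ (Ne.symm hk)]
          rfl
      | add x y hx hy =>
        simp [DirectSum.add_apply, hx, hy]
    ext m i
    rw [← key x m i, hx]
    simp
  · rw [← AddMonoidHom.range_eq_top, eq_top_iff]
    rintro ⟨_, f, rfl⟩ -
    classical
    have hsingle (i : ι) (b : B) : e.mulVecLin.rangeRestrict (Pi.single i b) ∈
        (DirectSum.coeAddMonoidHom (e.rangeGrading 𝒜 d)).range := by
      induction b using DirectSum.Decomposition.inductionOn 𝒜 with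
      | zero => simp
      | @homogeneous k b =>
        have : e.mulVecLin.rangeRestrict (Pi.single i (b : B)) ∈
            e.rangeGrading 𝒜 d (k + d i) := by
          intro j
          change (e *ᵥ Pi.single i (b : B)) j ∈ _
          rw [Matrix.mulVec_single, Pi.smul_apply, Matrix.col_apply,
            MulOpposite.smul_eq_mul_unop, MulOpposite.unop_op]
          by_cases hij : d j = d i
          · rw [hij, add_sub_cancel_right]
            simpa using SetLike.mul_mem_graded (he0 j i) b.2
          · rw [hd j i hij, zero_mul]
            exact zero_mem _
        exact ⟨DirectSum.of _ _ ⟨_, this⟩, by rw [DirectSum.coeAddMonoidHom_of]⟩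
      | add b c hb hc =>
        rw [Pi.single_add, map_add]
        exact add_mem hb hc
    have hf : e.mulVecLin.rangeRestrict f = ∑ i, e.mulVecLin.rangeRestrict (Pi.single i (f i)) := by
      rw [← map_sum, Finset.univ_sum_single]
    change e.mulVecLin.rangeRestrict f ∈ _
    rw [hf]
    exact sum_mem fun i _ => hsingle i _

end GradedRange

theorem Matrix.projective_range_mulVecLin {B ι : Type*} [CommRing B] [Fintype ι] [DecidableEq ι]
    (e : Matrix ι ι B) (he : IsIdempotentElem e) :
    Module.Projective B (LinearMap.range e.mulVecLin) := by
  refine Module.Projective.of_split (LinearMap.range e.mulVecLin).subtype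
    e.mulVecLin.rangeRestrict ?_
  ext ⟨_, f, rfl⟩ : 2
  simp [Matrix.mulVec_mulVec, he.eq]

theorem DirectSum.Decomposition.exists_homogeneous_generators {M B : Type*} {P : Type v}
    [DecidableEq M] [CommRing B] [AddCommGroup P] [Module B P] [Module.Finite B P]
    (𝒢 : M → AddSubgroup P) [DirectSum.Decomposition 𝒢] :
    ∃ (ι : Type v) (_ : Fintype ι) (x : ι → P) (d : ι → M), (∀ i, x i ∈ 𝒢 (d i)) ∧
      Function.Surjective (Fintype.linearCombination B x) := by
  classical
  obtain ⟨t, ht⟩ := Module.Finite.fg_top (R := B) (M := P)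
  let s : Finset P := t.biUnion fun x => (DirectSum.decompose 𝒢 x).support.image
    fun m => (DirectSum.decompose 𝒢 x m : P)
  have hs (i : s) : ∃ m, (i : P) ∈ 𝒢 m := by
    obtain ⟨x, -, hy⟩ := Finset.mem_biUnion.mp i.2
    obtain ⟨m, -, hm⟩ := Finset.mem_image.mp hy
    exact ⟨m, hm ▸ SetLike.coe_mem _⟩
  choose d hd using hs
  refine ⟨s, inferInstance, Subtype.val, d, hd, ?_⟩
  rw [← LinearMap.range_eq_top, Fintype.range_linearCombination, Subtype.range_coe,
    eq_top_iff, ← ht, Submodule.span_le]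
  intro x hx
  rw [← DirectSum.sum_support_decompose 𝒢 x]
  refine sum_mem fun m hm => Submodule.subset_span ?_
  exact Finset.mem_biUnion.mpr ⟨x, hx, Finset.mem_image.mpr ⟨m, hm, rfl⟩⟩

theorem GradedRing.sub_decompose_zero_mem {M B : Type*} [AddCommGroup M] [DecidableEq M]
    [CommRing B] (𝒜 : M → AddSubgroup B) [GradedRing 𝒜] (I : Ideal B)
    (hIm : ∀ m : M, m ≠ 0 → ∀ x : B, x ∈ 𝒜 m → x ∈ I) (b : B) :
    b - (DirectSum.decompose 𝒜 b 0 : B) ∈ I := by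
  classical
  rw [← DirectSum.sum_support_decompose 𝒜 (b - (DirectSum.decompose 𝒜 b 0 : B))]
  refine sum_mem fun m _ => ?_
  by_cases hm : m = 0
  · subst hm
    simp
  · exact hIm m hm _ (SetLike.coe_mem _)

theorem Matrix.aeval_apply_eq_zero {R ι M : Type*} [CommRing R] [Fintype ι] [DecidableEq ι]
    (d : ι → M) (A : Matrix ι ι R) (hA : ∀ i j, d i ≠ d j → A i j = 0) (q : R[X]) (i j : ι)
    (hij : d i ≠ d j) : aeval A q i j = 0 := by
  induction q using Polynomial.induction_on generalizing i j with
  | C a =>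
    have : i ≠ j := fun h => hij (h ▸ rfl)
    simp [Matrix.algebraMap_matrix_apply, this]
  | add p q hp hq => simp [hp i j hij, hq i j hij]
  | monomial n a h =>
    rw [pow_succ, ← mul_assoc, map_mul, aeval_X, Matrix.mul_apply]
    refine Finset.sum_eq_zero fun k _ => ?_
    by_cases hik : d i = d k
    · rw [hA k j (hik ▸ hij), mul_zero]
    · rw [h i k hik, zero_mul]

section HomogeneousGenerators

variable {M B P ι : Type*} [AddCommGroup M] [DecidableEq M] [CommRing B]
  (𝒜 : M → AddSubgroup B) [GradedRing 𝒜] (I : Ideal B)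
  [AddCommGroup P] [Module B P] (𝒢 : M → AddSubgroup P)
  [Module (B ⧸ I) P] [IsScalarTower B (B ⧸ I) P]

theorem GradedRing.quotient_smul_mem [SetLike.GradedSMul 𝒜 𝒢]
    (hIm : ∀ m : M, m ≠ 0 → ∀ x : B, x ∈ 𝒜 m → x ∈ I)
    (c : B ⧸ I) {m : M} {y : P} (hy : y ∈ 𝒢 m) : c • y ∈ 𝒢 m := by
  obtain ⟨b, rfl⟩ := Ideal.Quotient.mk_surjective c
  have h : Ideal.Quotient.mk I b = Ideal.Quotient.mk I (DirectSum.decompose 𝒜 b 0 : B) :=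
    Ideal.Quotient.eq.mpr (GradedRing.sub_decompose_zero_mem 𝒜 I hIm b)
  have h2 : Ideal.Quotient.mk I (DirectSum.decompose 𝒜 b 0 : B) • y
      = (DirectSum.decompose 𝒜 b 0 : B) • y := algebraMap_smul (B ⧸ I) _ y
  rw [h, h2]
  simpa using SetLike.GradedSMul.smul_mem (SetLike.coe_mem (DirectSum.decompose 𝒜 b 0)) hy

variable [Fintype ι]

theorem GradedRing.decompose_sum_quotient_smul [SetLike.GradedSMul 𝒜 𝒢]
    [DirectSum.Decomposition 𝒢]
    (hIm : ∀ m : M, m ≠ 0 → ∀ x : B, x ∈ 𝒜 m → x ∈ I)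
    {x : ι → P} {d : ι → M} (hx : ∀ i, x i ∈ 𝒢 (d i)) (c : ι → B ⧸ I) (m : M) :
    (DirectSum.decompose 𝒢 (∑ i, c i • x i) m : P) = ∑ i, if d i = m then c i • x i else 0 := by
  rw [DirectSum.decompose_sum, DFinsupp.finsetSum_apply, AddSubgroup.val_finsetSum]
  refine Finset.sum_congr rfl fun i _ => ?_
  have h := GradedRing.quotient_smul_mem 𝒜 I 𝒢 hIm (c i) (hx i)
  split_ifs with hm
  · subst hm
    exact DirectSum.decompose_of_mem_same 𝒢 h
  · exact DirectSum.decompose_of_mem_ne 𝒢 h hm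

/-- A projector onto the projective module `P` written in homogeneous generators can be chosen
to respect degrees. -/
theorem GradedRing.exists_isIdempotentElem_quotient_matrix [DecidableEq ι]
    [SetLike.GradedSMul 𝒜 𝒢] [DirectSum.Decomposition 𝒢] [Module.Projective (B ⧸ I) P]
    (hIm : ∀ m : M, m ≠ 0 → ∀ x : B, x ∈ 𝒜 m → x ∈ I)
    {x : ι → P} {d : ι → M} (hx : ∀ i, x i ∈ 𝒢 (d i))
    (hspan : Function.Surjective (Fintype.linearCombination (B ⧸ I) x)) :
    ∃ c : Matrix ι ι (B ⧸ I), IsIdempotentElem c ∧ (∀ i j, d i ≠ d j → c i j = 0) ∧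
      (∀ j, ∑ i, c i j • x i = x j) ∧
      ∀ b : ι → B ⧸ I, ∑ j, b j • x j = 0 → c *ᵥ b = 0 := by
  obtain ⟨s, hs⟩ := Module.projective_lifting_property _ LinearMap.id hspan
  have hsx (y : P) : ∑ i, s y i • x i = y := by
    simpa [Fintype.linearCombination_apply] using LinearMap.congr_fun hs y
  let c : Matrix ι ι (B ⧸ I) := Matrix.of fun i j => if d i = d j then s (x j) i else 0
  have hcx (j : ι) : ∑ i, c i j • x i = x j := by
    have h := GradedRing.decompose_sum_quotient_smul 𝒜 I 𝒢 hIm hx (s (x j)) (d j)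
    rw [hsx, DirectSum.decompose_of_mem_same 𝒢 (hx j)] at h
    rw [h]
    exact Finset.sum_congr rfl fun i _ => by simp only [c, Matrix.of_apply, ite_smul, zero_smul]
  have hker (b : ι → B ⧸ I) (hb : ∑ j, b j • x j = 0) : c *ᵥ b = 0 := by
    ext i
    have h := GradedRing.decompose_sum_quotient_smul 𝒜 I 𝒢 hIm hx b (d i)
    rw [hb, DirectSum.decompose_zero] at h
    have h2 := congrArg (fun y => s y i) h
    simp only [DirectSum.zero_apply, ZeroMemClass.coe_zero, map_zero, Pi.zero_apply, map_sum,
      Finset.sum_apply, apply_ite s, map_smul] at h2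
    rw [Pi.zero_apply, h2, Matrix.mulVec, dotProduct]
    refine Finset.sum_congr rfl fun j _ => ?_
    by_cases hij : d j = d i
    · simp [c, hij, mul_comm]
    · simp [c, hij, Ne.symm hij]
  refine ⟨c, ?_, fun i j hij => by simp [c, hij], hcx, hker⟩
  ext i k
  have h := congrFun (hker (c.col k - Pi.single k 1) (by
    simp only [Pi.sub_apply, sub_smul, Finset.sum_sub_distrib, Matrix.col_apply, hcx]
    simp [Pi.single_apply])) i
  rw [Matrix.mulVec_sub, Matrix.mulVec_single_one, Pi.sub_apply, Pi.zero_apply, sub_eq_zero] at h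
  exact h

end HomogeneousGenerators

theorem GradedRing.exists_isIdempotentElem_matrix_lift {M B ι : Type*} [AddCommGroup M]
    [DecidableEq M] [CommRing B] [Fintype ι] [DecidableEq ι]
    (𝒜 : M → AddSubgroup B) [GradedRing 𝒜] (I : Ideal B)
    (hIm : ∀ m : M, m ≠ 0 → ∀ x : B, x ∈ 𝒜 m → x ∈ I)
    (hHens : HenselianRing (𝒜 0)
      (Ideal.comap ((SetLike.GradeZero.subring 𝒜).subtype : (𝒜 0) →+* B) I))
    (d : ι → M) (c : Matrix ι ι (B ⧸ I)) (hc : IsIdempotentElem c)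
    (hd : ∀ i j, d i ≠ d j → c i j = 0) :
    ∃ e : Matrix ι ι B, IsIdempotentElem e ∧ (∀ i j, e i j ∈ 𝒜 0) ∧
      (∀ i j, d i ≠ d j → e i j = 0) ∧ e.map (Ideal.Quotient.mk I) = c := by
  let φ : (𝒜 0) →+* B := (SetLike.GradeZero.subring 𝒜).subtype
  have hlift (a : B ⧸ I) : ∃ r : 𝒜 0, Ideal.Quotient.mk I (φ r) = a ∧ (a = 0 → r = 0) := by
    by_cases ha : a = 0
    · exact ⟨0, by simp [ha], fun _ => rfl⟩
    · obtain ⟨b, rfl⟩ := Ideal.Quotient.mk_surjective a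
      exact ⟨DirectSum.decompose 𝒜 b 0, (Ideal.Quotient.eq.mpr
        (GradedRing.sub_decompose_zero_mem 𝒜 I hIm b)).symm, fun h => absurd h ha⟩
  choose r hr hr0 using hlift
  let A : Matrix ι ι (𝒜 0) := c.map r
  let ψ : (𝒜 0) ⧸ I.comap φ →+* B ⧸ I := Ideal.quotientMap I φ le_rfl
  have hψ : Function.Injective ψ := Ideal.quotientMap_injective
  have hψA : (A.map (Ideal.Quotient.mk (I.comap φ))).map ψ = c := by
    ext i j
    simp only [A, ψ, Matrix.map_apply, Ideal.quotientMap_mk, hr]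
  have hA : IsIdempotentElem (A.map (Ideal.Quotient.mk (I.comap φ))) := by
    refine Matrix.map_injective hψ ?_
    beta_reduce
    rw [Matrix.map_mul, hψA, hc.eq]
  obtain ⟨q, hq, hqA⟩ := HenselianRing.exists_isIdempotentElem_matrix hHens A hA
  refine ⟨(aeval A q).map φ, ?_, fun i j => SetLike.coe_mem _, fun i j hij => ?_, ?_⟩
  · rw [IsIdempotentElem, ← Matrix.map_mul, hq.eq]
  · rw [Matrix.map_apply, Matrix.aeval_apply_eq_zero d A (fun i j h => hr0 _ (hd i j h)) q i j hij,
      map_zero]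
  · rw [← hψA]
    exact congrArg (Matrix.map · ψ) hqA

end

/-- Let `B` be a commutative ring graded by an abelian group `M`, and `I ⊆ B` a
homogeneous ideal with `I_m = B_m` for `m ≠ 0` such that `(B₀, I₀)` is a henselian
pair. Every finitely generated `M`-graded `B`-module `P` annihilated by `I` and
projective over `B/I` is the reduction of a finitely generated graded projective
`B`-module `E`: there is a surjective graded `B`-linear map `E → P` with kernel
`I • E`. -/
theorem graded_henselian_projective_descends
    {M : Type w} [AddCommGroup M] [DecidableEq M]
    {B : Type u} [CommRing B] (𝒜 : M → AddSubgroup B) [GradedRing 𝒜]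
    (I : Ideal B) (hI : Ideal.IsHomogeneous 𝒜 I)
    (hIm : ∀ m : M, m ≠ 0 → ∀ x : B, x ∈ 𝒜 m → x ∈ I)
    (hHens : HenselianRing (𝒜 0)
      (Ideal.comap ((SetLike.GradeZero.subring 𝒜).subtype : (𝒜 0) →+* B) I))
    {P : Type v} [AddCommGroup P] [Module B P]
    (𝒢 : M → AddSubgroup P) [SetLike.GradedSMul 𝒜 𝒢] [DirectSum.Decomposition 𝒢]
    [Module.Finite B P]
    [Module (B ⧸ I) P] [IsScalarTower B (B ⧸ I) P]
    (hann : ∀ a ∈ I, ∀ x : P, a • x = (0 : P))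
    [Module.Projective (B ⧸ I) P] :
    ∃ (E : Type (max u v)) (_ : AddCommGroup E) (_ : Module B E)
      (ℰ : M → AddSubgroup E) (_ : SetLike.GradedSMul 𝒜 ℰ)
      (_ : DirectSum.Decomposition ℰ),
      Module.Finite B E ∧ Module.Projective B E ∧
        ∃ u : E →ₗ[B] P, Function.Surjective u ∧
          (∀ m : M, ∀ x ∈ ℰ m, u x ∈ 𝒢 m) ∧
          LinearMap.ker u = I • (⊤ : Submodule B E) := by
  classical
  obtain ⟨ι, _, x, d, hx, hsurj⟩ :=
    DirectSum.Decomposition.exists_homogeneous_generators (B := B) 𝒢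
  have hsmul (b : B) (y : P) : Ideal.Quotient.mk I b • y = b • y := algebraMap_smul (B ⧸ I) b y
  obtain ⟨c, hc, hcd, hcx, hker⟩ :=
    GradedRing.exists_isIdempotentElem_quotient_matrix 𝒜 I 𝒢 hIm hx (by
      intro y
      obtain ⟨f, rfl⟩ := hsurj y
      exact ⟨fun i => Ideal.Quotient.mk I (f i), by
        simp [Fintype.linearCombination_apply, hsmul]⟩)
  obtain ⟨e, he, he0, hed, hec⟩ :=
    GradedRing.exists_isIdempotentElem_matrix_lift 𝒜 I hIm hHens d c hc hcd
  have hex (j : ι) : ∑ i, e i j • x i = x j := by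
    rw [← hcx j]
    exact Finset.sum_congr rfl fun i _ => by rw [← hsmul, ← hec, Matrix.map_apply]
  have hπ : Fintype.linearCombination B x ∘ₗ e.mulVecLin = Fintype.linearCombination B x := by
    refine LinearMap.pi_ext' fun j => LinearMap.ext_ring ?_
    simpa [Fintype.linearCombination_apply, Pi.single_apply] using hex j
  refine ⟨LinearMap.range e.mulVecLin, inferInstance, inferInstance, e.rangeGrading 𝒜 d,
    e.rangeGrading_gradedSMul 𝒜 d, (e.rangeGrading_isInternal 𝒜 d he0 hed).chooseDecomposition,
    inferInstance, e.projective_range_mulVecLin he,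
    Fintype.linearCombination B x ∘ₗ (LinearMap.range e.mulVecLin).subtype, ?_, ?_, ?_⟩
  · intro y
    obtain ⟨f, rfl⟩ := hsurj y
    exact ⟨e.mulVecLin.rangeRestrict f, LinearMap.congr_fun hπ f⟩
  · intro m f hf
    rw [LinearMap.comp_apply, Fintype.linearCombination_apply]
    refine sum_mem fun i _ => ?_
    simpa using SetLike.GradedSMul.smul_mem (hf i) (hx i)
  · refine le_antisymm (fun f hf => ?_) (Submodule.smul_le.mpr fun a ha f _ => ?_)
    · have hef : e.mulVec f.1 = f.1 := by
        obtain ⟨g, hg⟩ := f.2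
        rw [← hg, Matrix.mulVecLin_apply, Matrix.mulVec_mulVec, he.eq]
      have hfI (i : ι) : f.1 i ∈ I := by
        have h := congrFun (hker (fun j => Ideal.Quotient.mk I (f.1 j)) (by
          simp only [hsmul]
          exact hf)) i
        rw [← hef, ← Ideal.Quotient.eq_zero_iff_mem, RingHom.map_mulVec, hec]
        exact h
      have hsum : f = ∑ i, f.1 i • e.mulVecLin.rangeRestrict (Pi.single i 1) := by
        simp only [← map_smul, ← map_sum]
        exact Subtype.ext (by simpa [← pi_eq_sum_univ'] using hef.symm)
      rw [hsum]
      exact sum_mem fun i _ => Submodule.smul_mem_smul (hfI i) trivial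
    · rw [LinearMap.mem_ker, map_smul]
      exact hann a ha _
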